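/- Let x_1, …, x_n be data points with real filter values f_1, …, f_n, and let [a_1,b_1], …, [a_r,b_r] be intervals with a_j ≤ b_j. Define the deterministic assignment e* ∈ {0,1}^{n×r} by e*_{i,j} = 1 if f_i ∈ [a_j,b_j] and 0 otherwise. Then for every e ∈ {0,1}^{n×r}, the probability ∏_{i,j} (q_{a_j,b_j,δ}(f_i) if e_{i,j} = 1, else 1 − q_{a_j,b_j,δ}(f_i)) converges, as δ → 0⁺, to 1 if e = e* and to 0 otherwise. That is, the smooth cover assignment scheme A_δ converges in law to the standard (deterministic) cover assignment scheme A* as δ → 0. -/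

import Mathlib

/-- The smooth bump function `q_{a,b,δ}` used in the smooth relaxation of the
standard Mapper cover assignment scheme. -/
noncomputable def softMapperBump (a b δ t : ℝ) : ℝ :=
  if t ∈ Set.Icc a b then 1
  else if t ∈ Set.Ioo (a - δ) a then Real.exp (1 - 1 / (1 - ((a - t) / δ) ^ 2))
  else if t ∈ Set.Ioo b (b + δ) then Real.exp (1 - 1 / (1 - ((t - b) / δ) ^ 2))
  else 0

/-- For all small enough `δ > 0` the bump function at a fixed point agrees with the indicator of
`[a, b]`. -/
theorem eventually_softMapperBump_eq {a b : ℝ} (hab : a ≤ b) (t : ℝ) :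
    ∀ᶠ δ in nhdsWithin (0 : ℝ) (Set.Ioi 0),
      softMapperBump a b δ t = if t ∈ Set.Icc a b then 1 else 0 := by
  by_cases ht : t ∈ Set.Icc a b
  · simp only [softMapperBump, if_pos ht, Filter.eventually_true]
  · have hdist : 0 < max (a - t) (t - b) := by
      by_contra! h
      exact ht ⟨by linarith [le_max_left (a - t) (t - b)],
        by linarith [le_max_right (a - t) (t - b)]⟩
    filter_upwards [Ioo_mem_nhdsGT hdist] with δ hδ
    have hleft : t ∉ Set.Ioo (a - δ) a := by
      rintro ⟨h₁, h₂⟩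
      rcases lt_max_iff.1 hδ.2 with h | h <;> linarith [hδ.1]
    have hright : t ∉ Set.Ioo b (b + δ) := by
      rintro ⟨h₁, h₂⟩
      rcases lt_max_iff.1 hδ.2 with h | h <;> linarith [hδ.1]
    simp only [softMapperBump, if_neg ht, if_neg hleft, if_neg hright]

open Filter in
/-- The smooth cover assignment scheme `A_δ` converges in law, as `δ → 0⁺`, to
the standard (deterministic) cover assignment scheme `A*` given by
`A*_{i,j} = 1` exactly when `f_i ∈ [a_j, b_j]`. -/
theorem smooth_cover_assignment_tendsto_standard
    (n r : ℕ) (f : Fin n → ℝ) (a b : Fin r → ℝ) (hab : ∀ j, a j ≤ b j)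
    (estar : Fin n → Fin r → Bool)
    (hestar : ∀ i j, estar i j = true ↔ f i ∈ Set.Icc (a j) (b j)) :
    ∀ e : Fin n → Fin r → Bool,
      Tendsto
        (fun δ : ℝ => ∏ i, ∏ j,
          if e i j then softMapperBump (a j) (b j) δ (f i)
          else 1 - softMapperBump (a j) (b j) δ (f i))
        (nhdsWithin 0 (Set.Ioi 0))
        (nhds (if e = estar then (1 : ℝ) else 0)) := by
  intro e
  have hbump : ∀ᶠ δ in nhdsWithin (0 : ℝ) (Set.Ioi 0), ∀ i j,
      softMapperBump (a j) (b j) δ (f i) = if estar i j then 1 else 0 := by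
    simp only [eventually_all, hestar]
    exact fun i j => eventually_softMapperBump_eq (hab j) (f i)
  refine tendsto_const_nhds.congr' ?_
  filter_upwards [hbump] with δ hδ
  simp only [hδ]
  split_ifs with he
  · subst he
    refine (Finset.prod_eq_one fun i _ => Finset.prod_eq_one fun j _ => ?_).symm
    cases e i j <;> simp
  · obtain ⟨i, hi⟩ := Function.ne_iff.1 he
    obtain ⟨j, hij⟩ := Function.ne_iff.1 hi
    refine (Finset.prod_eq_zero (Finset.mem_univ i)
      (Finset.prod_eq_zero (Finset.mem_univ j) ?_)).symm
    revert hij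
    cases e i j <;> cases estar i j <;> simp
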